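/- arXiv:1403.3760 — 2 statements merged into one kernel-verified Lean document; each statement's English description precedes it below -/
import Mathlib

section
/- Lemma 5.5 (Existence of the local slope). Let U ⊆ ℝⁿ (n ≥ 1) be a bounded open set and let (u₁, u₂) be a pair of continuous real functions on the closure of U that is a viscosity solution of the system −Δ∞u₁ + u₁ − u₂ = 0, −Δ∞u₂ + u₂ − u₁ = 0 in U. Then for every x₀ ∈ U and every i ∈ {1,2}, the limit S_i⁺(x₀) := lim_{r→0⁺} S_i⁺(x₀,r) exists and is finite. -/
open Filter Metric Set Topology

noncomputable def secondDeriv {n : ℕ} (φ : EuclideanSpace ℝ (Fin n) → ℝ)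
    (x v : EuclideanSpace ℝ (Fin n)) : ℝ :=
  iteratedFDeriv ℝ 2 φ x ![v, v]

open scoped Classical in
noncomputable def laplInfPlus {n : ℕ} (φ : EuclideanSpace ℝ (Fin n) → ℝ)
    (x : EuclideanSpace ℝ (Fin n)) : ℝ :=
  if gradient φ x = 0 then
    sSup {t : ℝ | ∃ v : EuclideanSpace ℝ (Fin n), ‖v‖ = 1 ∧ t = secondDeriv φ x v}
  else secondDeriv φ x (gradient φ x) / ‖gradient φ x‖ ^ 2

open scoped Classical in
noncomputable def laplInfMinus {n : ℕ} (φ : EuclideanSpace ℝ (Fin n) → ℝ)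
    (x : EuclideanSpace ℝ (Fin n)) : ℝ :=
  if gradient φ x = 0 then
    sInf {t : ℝ | ∃ v : EuclideanSpace ℝ (Fin n), ‖v‖ = 1 ∧ t = secondDeriv φ x v}
  else secondDeriv φ x (gradient φ x) / ‖gradient φ x‖ ^ 2

/-- One half of the subsolution condition: `-Δ∞⁺φ(x₀) + u(x₀) - v(x₀) ≤ 0` at
local maximum points of `u - φ`. -/
def SubPair {n : ℕ} (U : Set (EuclideanSpace ℝ (Fin n)))
    (u v : EuclideanSpace ℝ (Fin n) → ℝ) : Prop :=
  ∀ φ : EuclideanSpace ℝ (Fin n) → ℝ, ContDiff ℝ 2 φ →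
    ∀ x₀ ∈ U, IsLocalMaxOn (fun x => u x - φ x) U x₀ →
      -laplInfPlus φ x₀ + u x₀ - v x₀ ≤ 0

def SuperPair {n : ℕ} (U : Set (EuclideanSpace ℝ (Fin n)))
    (u v : EuclideanSpace ℝ (Fin n) → ℝ) : Prop :=
  ∀ φ : EuclideanSpace ℝ (Fin n) → ℝ, ContDiff ℝ 2 φ →
    ∀ x₀ ∈ U, IsLocalMinOn (fun x => u x - φ x) U x₀ →
      0 ≤ -laplInfMinus φ x₀ + u x₀ - v x₀

/-- `(u₁, u₂)` is a viscosity subsolution of the system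
`-Δ∞u₁ + u₁ - u₂ = 0`, `-Δ∞u₂ + u₂ - u₁ = 0` in `U`. -/
def IsSubsolution {n : ℕ} (U : Set (EuclideanSpace ℝ (Fin n)))
    (u₁ u₂ : EuclideanSpace ℝ (Fin n) → ℝ) : Prop :=
  UpperSemicontinuousOn u₁ U ∧ UpperSemicontinuousOn u₂ U ∧
    SubPair U u₁ u₂ ∧ SubPair U u₂ u₁

/-- `(u₁, u₂)` is a viscosity supersolution of the system
`-Δ∞u₁ + u₁ - u₂ = 0`, `-Δ∞u₂ + u₂ - u₁ = 0` in `U`. -/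
def IsSupersolution {n : ℕ} (U : Set (EuclideanSpace ℝ (Fin n)))
    (u₁ u₂ : EuclideanSpace ℝ (Fin n) → ℝ) : Prop :=
  LowerSemicontinuousOn u₁ U ∧ LowerSemicontinuousOn u₂ U ∧
    SuperPair U u₁ u₂ ∧ SuperPair U u₂ u₁

def IsSolution {n : ℕ} (U : Set (EuclideanSpace ℝ (Fin n)))
    (u₁ u₂ : EuclideanSpace ℝ (Fin n) → ℝ) : Prop :=
  IsSubsolution U u₁ u₂ ∧ IsSupersolution U u₁ u₂

/-- First component of the generalized cone pair with vertex `x₀`. -/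
noncomputable def cone₁ {n : ℕ} (x₀ : EuclideanSpace ℝ (Fin n)) (C₁ C₂ a b : ℝ)
    (x : EuclideanSpace ℝ (Fin n)) : ℝ :=
  C₁ * Real.exp (Real.sqrt 2 * ‖x - x₀‖) + C₂ * Real.exp (-(Real.sqrt 2 * ‖x - x₀‖)) +
    a * ‖x - x₀‖ + b

/-- Second component of the generalized cone pair with vertex `x₀`. -/
noncomputable def cone₂ {n : ℕ} (x₀ : EuclideanSpace ℝ (Fin n)) (C₁ C₂ a b : ℝ)
    (x : EuclideanSpace ℝ (Fin n)) : ℝ :=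
  -C₁ * Real.exp (Real.sqrt 2 * ‖x - x₀‖) - C₂ * Real.exp (-(Real.sqrt 2 * ‖x - x₀‖)) +
    a * ‖x - x₀‖ + b

noncomputable def sphMax {n : ℕ} (u : EuclideanSpace ℝ (Fin n) → ℝ)
    (x₀ : EuclideanSpace ℝ (Fin n)) (r : ℝ) : ℝ :=
  sSup (u '' sphere x₀ r)

noncomputable def sphMin {n : ℕ} (u : EuclideanSpace ℝ (Fin n) → ℝ)
    (x₀ : EuclideanSpace ℝ (Fin n)) (r : ℝ) : ℝ :=
  sInf (u '' sphere x₀ r)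

noncomputable def Splus {n : ℕ} (u : EuclideanSpace ℝ (Fin n) → ℝ)
    (x₀ : EuclideanSpace ℝ (Fin n)) (r : ℝ) : ℝ :=
  (sphMax u x₀ r - u x₀) / r

noncomputable def Sminus {n : ℕ} (u : EuclideanSpace ℝ (Fin n) → ℝ)
    (x₀ : EuclideanSpace ℝ (Fin n)) (r : ℝ) : ℝ :=
  (sphMin u x₀ r - u x₀) / r


section RadialTest

variable {n : ℕ}

theorem hasFDerivAt_radial {q : ℝ → ℝ} {d : ℝ} (x₀ x : EuclideanSpace ℝ (Fin n))
    (hq : HasDerivAt q d (‖x - x₀‖ ^ 2)) :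
    HasFDerivAt (fun z => q (‖z - x₀‖ ^ 2)) ((2 * d) • innerSL ℝ (x - x₀)) x := by
  have h1 : HasFDerivAt (fun z : EuclideanSpace ℝ (Fin n) => ‖z - x₀‖ ^ 2)
      (2 • innerSL ℝ (x - x₀)) x := by
    simpa using ((hasFDerivAt_id x).sub_const x₀).norm_sq
  refine (hq.comp_hasFDerivAt x h1).congr_fderiv ?_
  ext v
  simp
  ring

theorem gradient_radial {q : ℝ → ℝ} {d : ℝ} (x₀ x : EuclideanSpace ℝ (Fin n))
    (hq : HasDerivAt q d (‖x - x₀‖ ^ 2)) :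
    gradient (fun z => q (‖z - x₀‖ ^ 2)) x = (2 * d) • (x - x₀) := by
  refine HasGradientAt.gradient ?_
  rw [hasGradientAt_iff_hasFDerivAt]
  refine (hasFDerivAt_radial x₀ x hq).congr_fderiv ?_
  ext v
  simp

theorem secondDeriv_radial {q q' q'' : ℝ → ℝ} (hq : ∀ s, HasDerivAt q (q' s) s)
    (hq' : ∀ s, HasDerivAt q' (q'' s) s) (x₀ x v : EuclideanSpace ℝ (Fin n)) :
    secondDeriv (fun z => q (‖z - x₀‖ ^ 2)) x v =
      4 * q'' (‖x - x₀‖ ^ 2) * (inner ℝ (x - x₀) v) ^ 2 + 2 * q' (‖x - x₀‖ ^ 2) * ‖v‖ ^ 2 := by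
  have h1 : fderiv ℝ (fun z => q (‖z - x₀‖ ^ 2)) =
      fun z => (2 * q' (‖z - x₀‖ ^ 2)) • innerSL ℝ (z - x₀) :=
    funext fun z => (hasFDerivAt_radial x₀ z (hq _)).fderiv
  have h2 : HasFDerivAt (fun z : EuclideanSpace ℝ (Fin n) => innerSL ℝ (z - x₀))
      (innerSL ℝ : EuclideanSpace ℝ (Fin n) →L[ℝ] _) x :=
    (innerSL ℝ).hasFDerivAt.comp x ((hasFDerivAt_id x).sub_const x₀)
  have h3 : HasFDerivAt (fun z : EuclideanSpace ℝ (Fin n) =>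
      (2 * q' (‖z - x₀‖ ^ 2)) • innerSL ℝ (z - x₀)) _ x :=
    ((hasFDerivAt_radial x₀ x (hq' _)).const_mul 2).smul h2
  have h4 : (innerSL ℝ : EuclideanSpace ℝ (Fin n) →L[ℝ] EuclideanSpace ℝ (Fin n) →L[ℝ] ℝ) v v =
      ‖v‖ ^ 2 := real_inner_self_eq_norm_sq v
  rw [secondDeriv, iteratedFDeriv_two_apply, h1, h3.fderiv]
  simp [h4, inner_sub_left]
  ring

theorem laplInfPlus_radial {q q' q'' : ℝ → ℝ} (hq : ∀ s, HasDerivAt q (q' s) s)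
    (hq' : ∀ s, HasDerivAt q' (q'' s) s) {x₀ x : EuclideanSpace ℝ (Fin n)} (hx : x ≠ x₀)
    (h0 : q' (‖x - x₀‖ ^ 2) ≠ 0) :
    laplInfPlus (fun z => q (‖z - x₀‖ ^ 2)) x =
      4 * q'' (‖x - x₀‖ ^ 2) * ‖x - x₀‖ ^ 2 + 2 * q' (‖x - x₀‖ ^ 2) := by
  have hy : ‖x - x₀‖ ≠ 0 := by simpa [sub_eq_zero] using hx
  rw [laplInfPlus, gradient_radial x₀ x (hq _), if_neg (by simp [h0, sub_eq_zero, hx]),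
    secondDeriv_radial hq hq', inner_smul_right, real_inner_self_eq_norm_sq, norm_smul,
    mul_pow _ ‖x - x₀‖, Real.norm_eq_abs, sq_abs]
  field_simp

theorem laplInfPlus_radial_center (hn : 1 ≤ n) {q q' q'' : ℝ → ℝ}
    (hq : ∀ s, HasDerivAt q (q' s) s) (hq' : ∀ s, HasDerivAt q' (q'' s) s)
    (x₀ : EuclideanSpace ℝ (Fin n)) :
    laplInfPlus (fun z => q (‖z - x₀‖ ^ 2)) x₀ = 2 * q' 0 := by
  rw [laplInfPlus, gradient_radial x₀ x₀ (hq _), if_pos (by simp)]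
  have : {t : ℝ | ∃ v : EuclideanSpace ℝ (Fin n), ‖v‖ = 1 ∧
      t = secondDeriv (fun z => q (‖z - x₀‖ ^ 2)) x₀ v} = {2 * q' 0} := by
    ext t
    constructor
    · rintro ⟨v, hv, rfl⟩
      simp [secondDeriv_radial hq hq', hv]
    · rintro rfl
      exact ⟨EuclideanSpace.single ⟨0, hn⟩ 1, by simp, by simp [secondDeriv_radial hq hq']⟩
  rw [this, csSup_singleton]

end RadialTest

/-- The cubic Taylor polynomial of the square root at `ρ ^ 2` dominates it. -/
theorem le_sqrt_taylor {ρ t : ℝ} (hρ : 0 < ρ) (ht : 0 ≤ t) :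
    t ≤ ρ + (t ^ 2 - ρ ^ 2) / (2 * ρ) - (t ^ 2 - ρ ^ 2) ^ 2 / (8 * ρ ^ 3)
      + (t ^ 2 - ρ ^ 2) ^ 3 / (16 * ρ ^ 5) := by
  have h : ρ + (t ^ 2 - ρ ^ 2) / (2 * ρ) - (t ^ 2 - ρ ^ 2) ^ 2 / (8 * ρ ^ 3)
      + (t ^ 2 - ρ ^ 2) ^ 3 / (16 * ρ ^ 5) - t
      = (t - ρ) ^ 4 * (t ^ 2 + 4 * ρ * t + 5 * ρ ^ 2) / (16 * ρ ^ 5) := by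
    field_simp
    ring
  have : 0 ≤ (t - ρ) ^ 4 * (t ^ 2 + 4 * ρ * t + 5 * ρ ^ 2) / (16 * ρ ^ 5) := by positivity
  linarith

section Comparison

variable {n : ℕ} {U : Set (EuclideanSpace ℝ (Fin n))} {u v : EuclideanSpace ℝ (Fin n) → ℝ}
  {x₀ : EuclideanSpace ℝ (Fin n)} {K R : ℝ}

theorem isLocalMaxOn_of_ball {f g : EuclideanSpace ℝ (Fin n) → ℝ} {x₁ : EuclideanSpace ℝ (Fin n)}
    (hx₁ : x₁ ∈ ball x₀ R) (hmax : IsMaxOn f (closedBall x₀ R) x₁) (hle : ∀ x, g x ≤ f x)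
    (heq : g x₁ = f x₁) : IsLocalMaxOn g U x₁ := by
  refine Filter.Eventually.filter_mono nhdsWithin_le_nhds ?_
  filter_upwards [isOpen_ball.mem_nhds hx₁] with x hx
  rw [heq]
  exact (hle x).trans (hmax (ball_subset_closedBall hx))

/-- No strict radial supersolution with nonvanishing slope touches `u` from above off its vertex. -/
theorem not_isMaxOn_sub_cone (hsub : SubPair U u v) (hball : closedBall x₀ R ⊆ U)
    (hK : ∀ x ∈ closedBall x₀ R, v x - u x < K) {b : ℝ} (hb : 0 ≤ b)
    {x₁ : EuclideanSpace ℝ (Fin n)} (hx₁ : x₁ ∈ ball x₀ R) (hne : x₁ ≠ x₀)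
    (hslope : b ≠ K * ‖x₁ - x₀‖) :
    ¬ IsMaxOn (fun x => u x - (b * ‖x - x₀‖ - K / 2 * ‖x - x₀‖ ^ 2)) (closedBall x₀ R) x₁ := by
  intro hmax
  set ρ := ‖x₁ - x₀‖ with hρdef
  have hρ : 0 < ρ := by simpa [hρdef, sub_eq_zero] using hne
  let q : ℝ → ℝ := fun s => b * (ρ + (s - ρ ^ 2) / (2 * ρ) - (s - ρ ^ 2) ^ 2 / (8 * ρ ^ 3)
      + (s - ρ ^ 2) ^ 3 / (16 * ρ ^ 5)) - K / 2 * s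
  let q' : ℝ → ℝ := fun s => b * (1 / (2 * ρ) - 2 * (s - ρ ^ 2) / (8 * ρ ^ 3)
      + 3 * (s - ρ ^ 2) ^ 2 / (16 * ρ ^ 5)) - K / 2
  let q'' : ℝ → ℝ := fun s => b * (- 2 / (8 * ρ ^ 3) + 6 * (s - ρ ^ 2) / (16 * ρ ^ 5))
  have hw : ∀ s, HasDerivAt (fun s : ℝ => s - ρ ^ 2) 1 s := fun s => (hasDerivAt_id s).sub_const _
  have hq : ∀ s, HasDerivAt q (q' s) s := by
    intro s
    have := (((((hw s).div_const (2 * ρ)).const_add ρ).sub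
      (((hw s).pow 2).div_const (8 * ρ ^ 3))).add
      (((hw s).pow 3).div_const (16 * ρ ^ 5))).const_mul b |>.sub
      ((hasDerivAt_id s).const_mul (K / 2))
    refine this.congr_deriv ?_
    simp [q']
  have hq' : ∀ s, HasDerivAt q' (q'' s) s := by
    intro s
    have := ((((((hw s).const_mul 2).div_const (8 * ρ ^ 3)).const_sub (1 / (2 * ρ))).add
      ((((hw s).pow 2).const_mul 3).div_const (16 * ρ ^ 5))).const_mul b).sub_const (K / 2)
    refine this.congr_deriv ?_
    simp only [q'']
    ring
  have hcd : ContDiff ℝ 2 (fun x => q (‖x - x₀‖ ^ 2)) := by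
    have : ContDiff ℝ 2 (fun x => ‖x - x₀‖ ^ 2) := (contDiff_id.sub contDiff_const).norm_sq ℝ
    have hqc : ContDiff ℝ 2 q := by
      simp only [q, div_eq_mul_inv]
      fun_prop
    exact hqc.comp this
  have hloc : IsLocalMaxOn (fun x => u x - q (‖x - x₀‖ ^ 2)) U x₁ := by
    refine isLocalMaxOn_of_ball hx₁ hmax (fun x => ?_) ?_
    · have := mul_le_mul_of_nonneg_left (le_sqrt_taylor hρ (norm_nonneg (x - x₀))) hb
      simp only [q]
      linarith
    · simp [q, ← hρdef]
  have hx₁' := ball_subset_closedBall hx₁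
  have hq'ρ : q' (ρ ^ 2) = (b - K * ρ) / (2 * ρ) := by
    simp only [q']
    field_simp
    ring
  have h1 := hsub _ hcd x₁ (hball hx₁') hloc
  rw [laplInfPlus_radial hq hq' hne, ← hρdef] at h1
  · have h2 : 4 * q'' (ρ ^ 2) * ρ ^ 2 + 2 * q' (ρ ^ 2) = -K := by
      rw [hq'ρ]
      simp only [q'']
      field_simp
      ring
    have := hK x₁ hx₁'
    linarith
  · rw [← hρdef, hq'ρ]
    exact div_ne_zero (sub_ne_zero.2 hslope) (by positivity)

theorem not_isMaxOn_add_sq_center (hn : 1 ≤ n) (hsub : SubPair U u v)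
    (hball : closedBall x₀ R ⊆ U) (hK : ∀ x ∈ closedBall x₀ R, v x - u x < K) (hR : 0 < R) :
    ¬ IsMaxOn (fun x => u x + K / 2 * ‖x - x₀‖ ^ 2) (closedBall x₀ R) x₀ := by
  intro hmax
  have hq : ∀ s, HasDerivAt (fun s : ℝ => -(K / 2) * s) (-(K / 2)) s := fun s => by
    simpa using (hasDerivAt_id s).const_mul (-(K / 2))
  have hq' : ∀ s, HasDerivAt (fun _ : ℝ => -(K / 2)) 0 s := fun s => hasDerivAt_const _ _
  have hcd : ContDiff ℝ 2 (fun x => -(K / 2) * ‖x - x₀‖ ^ 2) :=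
    contDiff_const.mul ((contDiff_id.sub contDiff_const).norm_sq ℝ)
  have hloc : IsLocalMaxOn (fun x => u x - -(K / 2) * ‖x - x₀‖ ^ 2) U x₀ :=
    isLocalMaxOn_of_ball (mem_ball_self hR) hmax (fun x => by linarith) (by simp)
  have h0 := mem_closedBall_self (x := x₀) hR.le
  have h1 := hsub _ hcd x₀ (hball h0) hloc
  rw [laplInfPlus_radial_center hn hq hq'] at h1
  have := hK x₀ h0
  linarith

theorem exists_sphere_of_ball_not_isMaxOn {f : EuclideanSpace ℝ (Fin n) → ℝ} (hR : 0 < R)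
    (hf : ContinuousOn f (closedBall x₀ R))
    (h : ∀ x ∈ ball x₀ R, ¬ IsMaxOn f (closedBall x₀ R) x) :
    ∃ y ∈ sphere x₀ R, IsMaxOn f (closedBall x₀ R) y := by
  obtain ⟨y, hy, hmax⟩ := (isCompact_closedBall x₀ R).exists_isMaxOn
    ⟨x₀, mem_closedBall_self hR.le⟩ hf
  refine ⟨y, ?_, hmax⟩
  by_contra hs
  exact h y (lt_of_le_of_ne hy hs) hmax

theorem le_sphMax (hu : ContinuousOn u (closedBall x₀ R)) {y : EuclideanSpace ℝ (Fin n)}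
    (hy : y ∈ sphere x₀ R) : u y ≤ sphMax u x₀ R :=
  le_csSup (((isCompact_sphere x₀ R).image_of_continuousOn
    (hu.mono sphere_subset_closedBall)).bddAbove) ⟨y, hy, rfl⟩

theorem center_le_sphMax_add (hn : 1 ≤ n) (hsub : SubPair U u v) (hball : closedBall x₀ R ⊆ U)
    (hu : ContinuousOn u (closedBall x₀ R)) (hKpos : 0 < K)
    (hK : ∀ x ∈ closedBall x₀ R, v x - u x < K) (hR : 0 < R) :
    u x₀ ≤ sphMax u x₀ R + K / 2 * R ^ 2 := by
  obtain ⟨y, hy, hmax⟩ := exists_sphere_of_ball_not_isMaxOn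
    (f := fun x => u x + K / 2 * ‖x - x₀‖ ^ 2) hR (by fun_prop) (by
      intro x hx hmax
      by_cases hne : x = x₀
      · subst hne
        exact not_isMaxOn_add_sq_center hn hsub hball hK hR hmax
      · have hpos : 0 < ‖x - x₀‖ := by simpa [sub_eq_zero] using hne
        refine not_isMaxOn_sub_cone hsub hball hK le_rfl hx hne (by positivity) ?_
        simpa using hmax)
  have h1 := hmax (mem_closedBall_self hR.le)
  have h2 := le_sphMax hu hy
  have h3 : ‖y - x₀‖ = R := by simpa [dist_eq_norm] using hy
  simp only [mem_ofPred_eq, h3, sub_self, norm_zero] at h1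
  linarith

theorem le_cone_of_sphMax_le (hsub : SubPair U u v) (hball : closedBall x₀ R ⊆ U)
    (hu : ContinuousOn u (closedBall x₀ R)) (hKpos : 0 < K)
    (hK : ∀ x ∈ closedBall x₀ R, v x - u x < K) (hR : 0 < R) {b : ℝ} (hb : K * R ≤ b)
    (hM : sphMax u x₀ R ≤ u x₀ + b * R - K / 2 * R ^ 2) {x : EuclideanSpace ℝ (Fin n)}
    (hx : x ∈ closedBall x₀ R) :
    u x ≤ u x₀ + b * ‖x - x₀‖ - K / 2 * ‖x - x₀‖ ^ 2 := by
  obtain ⟨y, hy, hmax⟩ := (isCompact_closedBall x₀ R).exists_isMaxOn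
    ⟨x₀, mem_closedBall_self hR.le⟩
    (f := fun x => u x - (b * ‖x - x₀‖ - K / 2 * ‖x - x₀‖ ^ 2)) (by fun_prop)
  have hxy := hmax hx
  suffices h : u y - (b * ‖y - x₀‖ - K / 2 * ‖y - x₀‖ ^ 2) ≤ u x₀ by
    simp only [mem_ofPred_eq] at hxy
    linarith
  by_cases hs : y ∈ sphere x₀ R
  · have h2 := le_sphMax hu hs
    have h3 : ‖y - x₀‖ = R := by simpa [dist_eq_norm] using hs
    rw [h3]
    linarith
  · have hyb : y ∈ ball x₀ R := lt_of_le_of_ne hy hs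
    by_cases hne : y = x₀
    · simp [hne]
    · have h3 : ‖y - x₀‖ < R := by simpa [dist_eq_norm] using hyb
      have h4 : K * ‖y - x₀‖ < K * R := mul_lt_mul_of_pos_left h3 hKpos
      exact absurd hmax (not_isMaxOn_sub_cone hsub hball hK ((by positivity : 0 ≤ K * R).trans hb)
        hyb hne (by linarith))

theorem sphere_nonempty_of_one_le (hn : 1 ≤ n) (x₀ : EuclideanSpace ℝ (Fin n)) {r : ℝ}
    (hr : 0 ≤ r) : (sphere x₀ r).Nonempty := by
  have : Nonempty (Fin n) := ⟨⟨0, hn⟩⟩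
  exact NormedSpace.sphere_nonempty.2 hr

theorem Splus_add_nonneg (hn : 1 ≤ n) (hsub : SubPair U u v) (hball : closedBall x₀ R ⊆ U)
    (hu : ContinuousOn u (closedBall x₀ R)) (hKpos : 0 < K)
    (hK : ∀ x ∈ closedBall x₀ R, v x - u x < K) (hR : 0 < R) :
    0 ≤ Splus u x₀ R + K / 2 * R := by
  have h := center_le_sphMax_add hn hsub hball hu hKpos hK hR
  have : Splus u x₀ R + K / 2 * R = (sphMax u x₀ R + K / 2 * R ^ 2 - u x₀) / R := by
    rw [Splus]
    field_simp
    ring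
  rw [this]
  exact div_nonneg (by linarith) hR.le

theorem Splus_add_le_max (hn : 1 ≤ n) (hsub : SubPair U u v) (hball : closedBall x₀ R ⊆ U)
    (hu : ContinuousOn u (closedBall x₀ R)) (hKpos : 0 < K)
    (hK : ∀ x ∈ closedBall x₀ R, v x - u x < K) {r : ℝ} (hr : 0 < r) (hrR : r ≤ R) :
    Splus u x₀ r + K / 2 * r ≤ max (Splus u x₀ R + K / 2 * R) (K * R) := by
  have hR : 0 < R := hr.trans_le hrR
  set b := max (Splus u x₀ R + K / 2 * R) (K * R) with hb
  have hM : sphMax u x₀ R ≤ u x₀ + b * R - K / 2 * R ^ 2 := by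
    have h1 := mul_le_mul_of_nonneg_right
      (le_max_left (Splus u x₀ R + K / 2 * R) (K * R)) hR.le
    rw [← hb, add_mul, Splus, div_mul_cancel₀ _ hR.ne'] at h1
    linarith
  have h2 : sphMax u x₀ r ≤ u x₀ + b * r - K / 2 * r ^ 2 := by
    refine csSup_le ((sphere_nonempty_of_one_le hn x₀ hr.le).image u) ?_
    rintro _ ⟨x, hx, rfl⟩
    have h3 : ‖x - x₀‖ = r := by simpa [dist_eq_norm] using hx
    have h4 := le_cone_of_sphMax_le hsub hball hu hKpos hK hR (le_max_right _ _) hM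
      (closedBall_subset_closedBall hrR (sphere_subset_closedBall hx))
    rwa [h3] at h4
  have h5 : Splus u x₀ r ≤ b - K / 2 * r := by
    rw [Splus, div_le_iff₀ hr]
    linarith
  linarith

end Comparison

theorem exists_tendsto_of_le_max {T : ℝ → ℝ} {K R₀ : ℝ} (hR₀ : 0 < R₀) (hK : 0 < K)
    (h0 : ∀ r, 0 < r → r ≤ R₀ → 0 ≤ T r)
    (hT : ∀ r R, 0 < r → r ≤ R → R ≤ R₀ → T r ≤ max (T R) (K * R)) :
    ∃ L, Tendsto T (𝓝[>] 0) (𝓝 L) := by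
  set A : Set ℝ := (fun R => max (T R) (K * R)) '' Ioc 0 R₀ with hA
  have hne : A.Nonempty := ⟨_, R₀, ⟨hR₀, le_rfl⟩, rfl⟩
  have hbd : ∀ a ∈ A, 0 ≤ a := by
    rintro _ ⟨R, hR, rfl⟩
    exact (h0 R hR.1 hR.2).trans (le_max_left _ _)
  have hL : 0 ≤ sInf A := le_csInf hne hbd
  refine ⟨sInf A, tendsto_order.2 ⟨fun a ha => ?_, fun a ha => ?_⟩⟩
  · have key : ∀ᶠ r in 𝓝[>] (0 : ℝ), sInf A ≤ T r := by
      rcases hL.eq_or_lt with h | h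
      · filter_upwards [Ioc_mem_nhdsGT hR₀] with r hr
        rw [← h]
        exact h0 r hr.1 hr.2
      · filter_upwards [Ioc_mem_nhdsGT hR₀, Ioo_mem_nhdsGT (div_pos h hK)] with r hr hr'
        have h1 : sInf A ≤ max (T r) (K * r) := csInf_le ⟨0, hbd⟩ ⟨r, hr, rfl⟩
        have h2 := (lt_div_iff₀' hK).1 hr'.2
        exact (le_max_iff.1 h1).resolve_right h2.not_ge
    exact key.mono fun r hr => ha.trans_le hr
  · obtain ⟨_, ⟨R, hR, rfl⟩, hlt⟩ := exists_lt_of_csInf_lt hne ha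
    filter_upwards [Ioc_mem_nhdsGT hR.1] with r hr
    exact (hT r R hr.1 hr.2 hR.2).trans_lt hlt

theorem exists_tendsto_Splus {n : ℕ} (hn : 1 ≤ n) {U : Set (EuclideanSpace ℝ (Fin n))}
    (hU : IsOpen U) {u v : EuclideanSpace ℝ (Fin n) → ℝ} (hu : ContinuousOn u U)
    (hv : ContinuousOn v U) (hsub : SubPair U u v) {x₀ : EuclideanSpace ℝ (Fin n)}
    (hx₀ : x₀ ∈ U) : ∃ S : ℝ, Tendsto (fun r => Splus u x₀ r) (𝓝[>] (0 : ℝ)) (𝓝 S) := by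
  set K := |v x₀ - u x₀| + 1 with hKdef
  have hKpos : 0 < K := by positivity
  have hlt : ∀ᶠ x in 𝓝 x₀, v x - u x < K :=
    ((hv.sub hu).continuousAt (hU.mem_nhds hx₀)).eventually_lt_const
      ((le_abs_self _).trans_lt (lt_add_one _))
  obtain ⟨R₀, hR₀, hsubset⟩ :=
    nhds_basis_closedBall.mem_iff.1 (Filter.inter_mem hlt (hU.mem_nhds hx₀))
  have hsmall : ∀ R ≤ R₀, closedBall x₀ R ⊆ U ∧ ∀ x ∈ closedBall x₀ R, v x - u x < K :=
    fun R hR => ⟨fun x hx => (hsubset (closedBall_subset_closedBall hR hx)).2,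
      fun x hx => (hsubset (closedBall_subset_closedBall hR hx)).1⟩
  obtain ⟨L, hL⟩ := exists_tendsto_of_le_max (T := fun r => Splus u x₀ r + K / 2 * r) hR₀ hKpos
    (fun r hr hr' => Splus_add_nonneg hn hsub (hsmall r hr').1 (hu.mono (hsmall r hr').1) hKpos
      (hsmall r hr').2 hr)
    (fun r R hr hrR hR => Splus_add_le_max hn hsub (hsmall R hR).1 (hu.mono (hsmall R hR).1) hKpos
      (hsmall R hR).2 hr hrR)
  have hlin : Tendsto (fun r : ℝ => K / 2 * r) (𝓝[>] 0) (𝓝 (K / 2 * 0)) :=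
    (tendsto_id.const_mul (K / 2)).mono_left nhdsWithin_le_nhds
  exact ⟨_, by simpa using hL.sub hlin⟩

/-- Lemma 5.5: the limit `S_i⁺(x₀) = lim_{r→0⁺} S_i⁺(x₀,r)` exists and is finite. -/
theorem slope_limit_exists {n : ℕ} (hn : 1 ≤ n)
    {U : Set (EuclideanSpace ℝ (Fin n))} (hUo : IsOpen U) (hUb : Bornology.IsBounded U)
    {u₁ u₂ : EuclideanSpace ℝ (Fin n) → ℝ}
    (hu₁ : ContinuousOn u₁ (closure U)) (hu₂ : ContinuousOn u₂ (closure U))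
    (hsol : IsSolution U u₁ u₂) :
    ∀ x₀ ∈ U,
      (∃ S : ℝ, Tendsto (fun r => Splus u₁ x₀ r) (𝓝[>] (0:ℝ)) (𝓝 S)) ∧
      (∃ S : ℝ, Tendsto (fun r => Splus u₂ x₀ r) (𝓝[>] (0:ℝ)) (𝓝 S)) := by
  exact fun x₀ hx₀ =>
    ⟨exists_tendsto_Splus hn hUo (hu₁.mono subset_closure) (hu₂.mono subset_closure)
      hsol.1.2.2.1 hx₀,
    exists_tendsto_Splus hn hUo (hu₂.mono subset_closure) (hu₁.mono subset_closure)
      hsol.1.2.2.2 hx₀⟩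
end

section
/- Generalized cones solve the system away from the vertex. Let n ≥ 1, x₀ ∈ ℝⁿ, and C₁, C₂, a, b ∈ ℝ, and let (ψ₁, ψ₂) be the generalized cone pair with vertex x₀ and these parameters. Then (ψ₁, ψ₂) is a viscosity solution of the system −Δ∞ψ₁ + ψ₁ − ψ₂ = 0, −Δ∞ψ₂ + ψ₂ − ψ₁ = 0 in the open set ℝⁿ \ {x₀}. -/
open Filter Metric Set Topology

/-- A twice differentiable function of one variable has nonpositive second derivative at an
interior local maximum. -/
theorem second_deriv_nonpos_of_isLocalMax {g g' : ℝ → ℝ} {t d : ℝ}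
    (hg : ∀ᶠ s in 𝓝 t, HasDerivAt g (g' s) s) (hg' : HasDerivAt g' d t) (hmax : IsLocalMax g t) :
    d ≤ 0 := by
  by_contra! hd
  have hderiv : deriv g =ᶠ[𝓝 t] g' := hg.mono fun s hs => hs.deriv
  have hdd : deriv (deriv g) t = d := hderiv.deriv_eq.trans hg'.deriv
  have hmin : IsLocalMin g t :=
    isLocalMin_of_deriv_deriv_pos (hdd ▸ hd) hmax.deriv_eq_zero hg.self_of_nhds.continuousAt
  have hconst : g =ᶠ[𝓝 t] fun _ => g t := by
    filter_upwards [hmax, hmin] with s h₁ h₂ using le_antisymm h₁ h₂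
  have hzero : deriv (deriv g) t = 0 := by
    rw [hconst.deriv.deriv_eq]
    simp
  linarith

section

variable {n : ℕ}

theorem secondDeriv_smul (φ : EuclideanSpace ℝ (Fin n) → ℝ) (x v : EuclideanSpace ℝ (Fin n))
    (c : ℝ) : secondDeriv φ x (c • v) = c ^ 2 * secondDeriv φ x v := by
  simp [secondDeriv, iteratedFDeriv_two_apply]
  ring

theorem secondDeriv_neg (φ : EuclideanSpace ℝ (Fin n) → ℝ) (x v : EuclideanSpace ℝ (Fin n)) :
    secondDeriv (-φ) x v = -secondDeriv φ x v := by
  simp [secondDeriv, iteratedFDeriv_neg_apply]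

theorem gradient_neg_fun (φ : EuclideanSpace ℝ (Fin n) → ℝ) (x : EuclideanSpace ℝ (Fin n)) :
    gradient (-φ) x = -gradient φ x := by
  simp [gradient, fderiv_neg]

theorem laplInfPlus_neg (φ : EuclideanSpace ℝ (Fin n) → ℝ) (x : EuclideanSpace ℝ (Fin n)) :
    laplInfPlus (-φ) x = -laplInfMinus φ x := by
  unfold laplInfPlus laplInfMinus
  rw [gradient_neg_fun]
  by_cases h : gradient φ x = 0
  · rw [if_pos (by simpa using h), if_pos h, ← Real.sSup_neg]
    congr 1
    ext t
    simp [secondDeriv_neg, neg_eq_iff_eq_neg]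
  · rw [if_neg (by simpa using h), if_neg h, secondDeriv_neg, norm_neg,
      show -gradient φ x = (-1 : ℝ) • gradient φ x by simp, secondDeriv_smul]
    ring

/-- If the gradient of `φ` is parallel to the unit vector `ν`, then the upper infinity Laplacian
of `φ` dominates its second derivative in the direction `ν`. -/
theorem secondDeriv_le_laplInfPlus {φ : EuclideanSpace ℝ (Fin n) → ℝ}
    {x ν : EuclideanSpace ℝ (Fin n)} (hν : ‖ν‖ = 1) {c : ℝ} (hc : gradient φ x = c • ν) :
    secondDeriv φ x ν ≤ laplInfPlus φ x := by
  unfold laplInfPlus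
  split_ifs with h
  · refine le_csSup ⟨‖iteratedFDeriv ℝ 2 φ x‖, ?_⟩ ⟨ν, hν, rfl⟩
    rintro _ ⟨v, hv, rfl⟩
    refine (le_abs_self _).trans ?_
    simpa [secondDeriv, Fin.prod_univ_two, hv] using (iteratedFDeriv ℝ 2 φ x).le_opNorm ![v, v]
  · have hc0 : c ≠ 0 := by
      rintro rfl
      exact h (by simpa using hc)
    rw [hc, secondDeriv_smul, norm_smul, hν, mul_one, Real.norm_eq_abs, sq_abs,
      mul_div_cancel_left₀ _ (pow_ne_zero 2 hc0)]

theorem superPair_of_subPair_neg {U : Set (EuclideanSpace ℝ (Fin n))}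
    {u v : EuclideanSpace ℝ (Fin n) → ℝ} (h : SubPair U (-u) (-v)) : SuperPair U u v := by
  intro φ hφ x hx hmin
  have hmax : IsLocalMaxOn (fun y => (-u) y - (-φ) y) U x := by
    filter_upwards [hmin] with y hy
    simp only [Pi.neg_apply]
    linarith
  have := h (-φ) hφ.neg x hx hmax
  rw [laplInfPlus_neg] at this
  simp only [Pi.neg_apply] at this
  linarith

/-- A `C²` function touching a radial function from above away from the centre has gradient
parallel to the radial direction and dominates its radial second derivative. -/
theorem radial_touching {f f' : ℝ → ℝ} {d : ℝ} {φ : EuclideanSpace ℝ (Fin n) → ℝ}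
    {x₀ x : EuclideanSpace ℝ (Fin n)} (hφ : ContDiff ℝ 2 φ) (hx : x ≠ x₀)
    (hf : ∀ s, HasDerivAt f (f' s) s) (hf' : HasDerivAt f' d ‖x - x₀‖)
    (hmax : IsLocalMax (fun y => f ‖y - x₀‖ - φ y) x) :
    d ≤ laplInfPlus φ x := by
  have hne : x - x₀ ≠ 0 := sub_ne_zero.2 hx
  set r := ‖x - x₀‖ with hr
  have hr0 : 0 < r := norm_pos_iff.2 hne
  set ν : EuclideanSpace ℝ (Fin n) := r⁻¹ • (x - x₀) with hνdef
  have hν : ‖ν‖ = 1 := by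
    rw [hνdef, norm_smul, ← hr, norm_inv, Real.norm_of_nonneg hr0.le, inv_mul_cancel₀ hr0.ne']
  have hxν : x - x₀ = r • ν := by rw [hνdef, smul_inv_smul₀ hr0.ne']
  have hφd : Differentiable ℝ φ := hφ.differentiable (by norm_num)
  have hφ'd : Differentiable ℝ (fderiv ℝ φ) :=
    (hφ.fderiv_right (m := 1) (by norm_num)).differentiable (by norm_num)
  have hgrad : gradient φ x = f' r • ν := by
    have hnorm : HasFDerivAt (fun y : EuclideanSpace ℝ (Fin n) => ‖y - x₀‖)
        (innerSL ℝ ν) x := by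
      have h1 : HasFDerivAt (fun y : EuclideanSpace ℝ (Fin n) => √(‖y - x₀‖ ^ 2)) _ x :=
        (((hasFDerivAt_id x).sub_const x₀).norm_sq).sqrt (by simpa using hne)
      simp only [Real.sqrt_sq (norm_nonneg _)] at h1
      refine h1.congr_fderiv ?_
      ext w
      simp [hνdef, ← hr]
      field_simp
    have hcomp := ((hf r).comp_hasFDerivAt x hnorm).sub (hφd x).hasFDerivAt
    have hzero := hmax.hasFDerivAt_eq_zero hcomp
    have hfd : fderiv ℝ φ x = f' r • innerSL ℝ ν := (sub_eq_zero.1 hzero).symm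
    rw [gradient, hfd]
    apply ext_inner_right ℝ
    intro w
    simp [real_inner_smul_left]
  refine le_trans ?_ (secondDeriv_le_laplInfPlus hν hgrad)
  have hline : ∀ t : ℝ, HasDerivAt (fun s : ℝ => x + s • ν) ν t := fun t => by
    simpa using ((hasDerivAt_id t).smul_const ν).const_add x
  have hg1 : ∀ t, HasDerivAt (fun s => f (r + s) - φ (x + s • ν))
      (f' (r + t) - fderiv ℝ φ (x + t • ν) ν) t := fun t =>
    ((hf (r + t)).comp_const_add r t).sub
      ((hφd (x + t • ν)).hasFDerivAt.comp_hasDerivAt t (hline t))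
  have hg2 : HasDerivAt (fun t => f' (r + t) - fderiv ℝ φ (x + t • ν) ν)
      (d - secondDeriv φ x ν) 0 := by
    refine HasDerivAt.sub (HasDerivAt.comp_const_add r 0 (by simpa using hf')) ?_
    have h := (hφ'd (x + (0 : ℝ) • ν)).hasFDerivAt.comp_hasDerivAt 0 (hline 0)
    simpa [secondDeriv, iteratedFDeriv_two_apply] using h.clm_apply (hasDerivAt_const 0 ν)
  have hgmax : IsLocalMax (fun s => f (r + s) - φ (x + s • ν)) 0 := by
    have ht : Tendsto (fun s : ℝ => x + s • ν) (𝓝 0) (𝓝 x) := by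
      simpa using (hline 0).continuousAt.tendsto
    filter_upwards [ht.eventually hmax, lt_mem_nhds (neg_lt_zero.2 hr0)] with s hs hsr
    have hnorm : ‖x + s • ν - x₀‖ = r + s := by
      rw [add_sub_right_comm, hxν, ← add_smul, norm_smul, hν, mul_one,
        Real.norm_of_nonneg (by linarith)]
    simpa [hnorm, ← hr] using hs
  linarith [second_deriv_nonpos_of_isLocalMax (Eventually.of_forall hg1) hg2 hgmax]

theorem cone₂_eq_cone₁ (x₀ : EuclideanSpace ℝ (Fin n)) (C₁ C₂ a b : ℝ) :
    cone₂ x₀ C₁ C₂ a b = cone₁ x₀ (-C₁) (-C₂) a b := by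
  ext x
  simp only [cone₁, cone₂]
  ring

theorem neg_cone₁ (x₀ : EuclideanSpace ℝ (Fin n)) (C₁ C₂ a b : ℝ) :
    -cone₁ x₀ C₁ C₂ a b = cone₁ x₀ (-C₁) (-C₂) (-a) (-b) := by
  ext x
  simp only [cone₁, Pi.neg_apply]
  ring

theorem continuous_cone₁ (x₀ : EuclideanSpace ℝ (Fin n)) (C₁ C₂ a b : ℝ) :
    Continuous (cone₁ x₀ C₁ C₂ a b) := by
  unfold cone₁
  fun_prop

theorem subPair_cone₁ (x₀ : EuclideanSpace ℝ (Fin n)) (C₁ C₂ a b : ℝ) :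
    SubPair {x₀}ᶜ (cone₁ x₀ C₁ C₂ a b) (cone₁ x₀ (-C₁) (-C₂) a b) := by
  intro φ hφ x hx hmax
  have hsq : √2 * √2 = 2 := Real.mul_self_sqrt (by norm_num)
  have hlin : ∀ s, HasDerivAt (fun s : ℝ => √2 * s) √2 s := fun s => by
    simpa using (hasDerivAt_id s).const_mul √2
  have hf : ∀ s, HasDerivAt
      (fun s => C₁ * Real.exp (√2 * s) + C₂ * Real.exp (-(√2 * s)) + a * s + b)
      (C₁ * (Real.exp (√2 * s) * √2) + C₂ * (Real.exp (-(√2 * s)) * -√2) + a) s := fun s => by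
    simpa using ((((hlin s).exp.const_mul C₁).add ((hlin s).neg.exp.const_mul C₂)).add
      ((hasDerivAt_id s).const_mul a)).add_const b
  have hf' : ∀ s, HasDerivAt
      (fun s => C₁ * (Real.exp (√2 * s) * √2) + C₂ * (Real.exp (-(√2 * s)) * -√2) + a)
      (C₁ * (Real.exp (√2 * s) * √2 * √2) + C₂ * (Real.exp (-(√2 * s)) * -√2 * -√2)) s :=
    fun s => ((((hlin s).exp.mul_const √2).const_mul C₁).add
      (((hlin s).neg.exp.mul_const (-√2)).const_mul C₂)).add_const a
  have hle := radial_touching hφ hx hf (hf' ‖x - x₀‖)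
    (hmax.isLocalMax (isOpen_compl_singleton.mem_nhds hx))
  simp only [mul_assoc, neg_mul_neg, hsq] at hle
  simp only [cone₁]
  linarith

theorem superPair_cone₁ (x₀ : EuclideanSpace ℝ (Fin n)) (C₁ C₂ a b : ℝ) :
    SuperPair {x₀}ᶜ (cone₁ x₀ C₁ C₂ a b) (cone₁ x₀ (-C₁) (-C₂) a b) := by
  apply superPair_of_subPair_neg
  rw [neg_cone₁, neg_cone₁]
  exact subPair_cone₁ x₀ _ _ _ _

end

/-- Generalized cones solve the system away from the vertex. -/
theorem cones_solve_away_from_vertex {n : ℕ} (hn : 1 ≤ n)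
    (x₀ : EuclideanSpace ℝ (Fin n)) (C₁ C₂ a b : ℝ) :
    IsSolution ({x₀}ᶜ : Set (EuclideanSpace ℝ (Fin n))) (cone₁ x₀ C₁ C₂ a b) (cone₂ x₀ C₁ C₂ a b) := by
  have hu₁ := continuous_cone₁ x₀ C₁ C₂ a b
  have hu₂ := continuous_cone₁ x₀ (-C₁) (-C₂) a b
  have hsub := subPair_cone₁ x₀ (-C₁) (-C₂) a b
  have hsup := superPair_cone₁ x₀ (-C₁) (-C₂) a b
  rw [neg_neg, neg_neg] at hsub hsup
  rw [cone₂_eq_cone₁]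
  exact ⟨⟨hu₁.upperSemicontinuous.upperSemicontinuousOn _,
      hu₂.upperSemicontinuous.upperSemicontinuousOn _, subPair_cone₁ x₀ C₁ C₂ a b, hsub⟩,
    hu₁.lowerSemicontinuous.lowerSemicontinuousOn _,
      hu₂.lowerSemicontinuous.lowerSemicontinuousOn _, superPair_cone₁ x₀ C₁ C₂ a b, hsup⟩
end
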